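/- arXiv:2401.04300 — 2 statements merged into one kernel-verified Lean document; each statement's English description precedes it below -/
import Mathlib

section
/- (ZFC) No subset of 2^ω of cardinality continuum is s₀-shiftable: for every X ⊆ 2^ω with |X| = 𝔠 there is a Marczewski null set Y ⊆ 2^ω with X + Y = 2^ω. -/
open Cardinal

abbrev Cantor : Type := ℕ → Bool

def cAdd (x y : Cantor) : Cantor := fun n => xor (x n) (y n)

def setAdd (X Y : Set Cantor) : Set Cantor := Set.image2 cAdd X Y

def IsTree (p : Set (List Bool)) : Prop := ∀ σ ∈ p, ∀ τ : List Bool, τ <+: σ → τ ∈ p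

def Splits (p : Set (List Bool)) (σ : List Bool) : Prop :=
  σ ++ [false] ∈ p ∧ σ ++ [true] ∈ p

def PerfTree (p : Set (List Bool)) : Prop :=
  p.Nonempty ∧ IsTree p ∧ ∀ σ ∈ p, ∃ τ ∈ p, σ <+: τ ∧ Splits p τ

def seg (x : Cantor) (n : ℕ) : List Bool := List.ofFn (fun i : Fin n => x i)

def body (p : Set (List Bool)) : Set Cantor := { x | ∀ n, seg x n ∈ p }

def shiftNode (t : Cantor) (σ : List Bool) : List Bool :=
  σ.mapIdx fun i b => xor b (t i)

def treeAdd (p : Set (List Bool)) (t : Cantor) : Set (List Bool) := shiftNode t '' p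

def SkewT (p : Set (List Bool)) : Prop :=
  ∀ σ ∈ p, ∀ τ ∈ p, Splits p σ → Splits p τ → σ.length = τ.length → σ = τ

def PerfectSet (P : Set Cantor) : Prop := Perfect P ∧ P.Nonempty

def MarczewskiNull (Y : Set Cantor) : Prop :=
  ∀ P : Set Cantor, PerfectSet P → ∃ Q, PerfectSet Q ∧ Q ⊆ P ∧ Q ∩ Y = ∅

def MarczewskiNullT (Y : Set Cantor) : Prop :=
  ∀ p, PerfTree p → ∃ q, PerfTree q ∧ q ⊆ p ∧ body q ∩ Y = ∅

def Shiftable (X : Set Cantor) : Prop :=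
  ∀ Y, MarczewskiNull Y → setAdd X Y ≠ Set.univ

lemma range_perfect (g : Cantor → Cantor) (hc : Continuous g) (hi : Function.Injective g) :
    PerfectSet (Set.range g) := by
  refine ⟨⟨?_, ?_⟩, Set.range_nonempty g⟩
  · exact (isCompact_range hc).isClosed
  · rintro _ ⟨x, rfl⟩
    rw [accPt_iff_nhds]
    intro U hU
    have h1 : g ⁻¹' U ∈ nhds x := hc.continuousAt hU
    -- sequence: flip nth coordinate
    have ht : Filter.Tendsto (fun n : ℕ => Function.update x n (!(x n))) Filter.atTop (nhds x) := by
      rw [tendsto_pi_nhds]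
      intro i
      refine tendsto_const_nhds.congr' ?_
      filter_upwards [Filter.eventually_gt_atTop i] with n hn
      rw [Function.update_of_ne (by omega)]
    obtain ⟨n, hn⟩ := (ht.eventually h1).exists
    refine ⟨g (Function.update x n (!(x n))), ⟨hn, ⟨_, rfl⟩⟩, ?_⟩
    intro h
    have := congrFun (hi h) n
    simp at this

lemma agree_nhds (x : Cantor) (k : ℕ) : {y : Cantor | ∀ i < k, y i = x i} ∈ nhds x := by
  have : {y : Cantor | ∀ i < k, y i = x i} = ⋂ i ∈ Finset.range k, {y : Cantor | y i = x i} := by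
    ext y; simp
  rw [this]
  apply (Filter.biInter_finset_mem _).2
  intro i _
  exact (continuous_apply i).continuousAt.preimage_mem_nhds (by simp : {x i} ∈ nhds (x i))

structure SNode (P : Set Cantor) where
  a : Bool → Cantor
  m : ℕ
  mem : ∀ b, a b ∈ P
  agree : ∀ b c, ∀ i < m, a b i = a c i
  val : ∀ b, a b m = b

lemma ext_exists (P : Set Cantor) (hP : PerfectSet P) (x : Cantor) (hx : x ∈ P) (k : ℕ) :
    ∃ N : SNode P, k ≤ N.m ∧ ∀ b, ∀ i < k, N.a b i = x i := by
  have h := hP.1.acc x hx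
  rw [accPt_iff_nhds] at h
  obtain ⟨y, ⟨hy1, hy2⟩, hne⟩ := h _ (agree_nhds x k)
  have hd : ∃ m, y m ≠ x m := Function.ne_iff.1 hne
  classical
  have hm := Nat.find_spec hd
  have hlt : ∀ i < Nat.find hd, y i = x i := fun i hi => by simpa using Nat.find_min hd hi
  set m := Nat.find hd
  have hk : k ≤ m := by
    by_contra hcon
    exact hm (hy1 m (by omega))
  refine ⟨⟨fun b => if x m = b then x else y, m, ?_, ?_, ?_⟩, hk, ?_⟩
  · intro b; split_ifs <;> assumption
  · intro b c i hi; split_ifs <;> simp [hlt i hi]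
  · intro b; split_ifs with h
    · exact h
    · revert hm h; cases x m <;> cases y m <;> cases b <;> simp
  · intro b i hi; dsimp only; split_ifs
    · rfl
    · exact hy1 i hi

noncomputable def ext (P : Set Cantor) (hP : PerfectSet P) (x : P) (k : ℕ) : SNode P :=
  (ext_exists P hP x.1 x.2 k).choose

lemma ext_spec (P : Set Cantor) (hP : PerfectSet P) (x : P) (k : ℕ) :
    k ≤ (ext P hP x k).m ∧ ∀ b, ∀ i < k, (ext P hP x k).a b i = x.1 i :=
  (ext_exists P hP x.1 x.2 k).choose_spec

noncomputable def node (P : Set Cantor) (hP : PerfectSet P) : ℕ → SNode P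
  | 0 => ext P hP ⟨hP.2.choose, hP.2.choose_spec⟩ 0
  | n + 1 => ext P hP ⟨(node P hP (n / 2)).a (decide (n % 2 = 1)), (node P hP (n / 2)).mem _⟩
      ((node P hP n).m + 1)
  termination_by n => n
  decreasing_by all_goals omega

lemma node_succ_m (P : Set Cantor) (hP : PerfectSet P) (n : ℕ) :
    (node P hP n).m < (node P hP (n + 1)).m := by
  conv_rhs => rw [node]
  exact (ext_spec P hP _ _).1

lemma node_mono (P : Set Cantor) (hP : PerfectSet P) : StrictMono fun n => (node P hP n).m :=
  strictMono_nat_of_lt_succ (node_succ_m P hP)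

def child (n : ℕ) (b : Bool) : ℕ := 2 * n + b.toNat + 1

lemma node_child (P : Set Cantor) (hP : PerfectSet P) (n : ℕ) (b c : Bool) (i : ℕ)
    (hi : i ≤ (node P hP n).m) :
    (node P hP (child n b)).a c i = (node P hP n).a b i := by
  unfold child
  have h := (ext_spec P hP ⟨(node P hP ((2 * n + b.toNat) / 2)).a
    (decide ((2 * n + b.toNat) % 2 = 1)), (node P hP ((2 * n + b.toNat) / 2)).mem _⟩
      ((node P hP (2 * n + b.toNat)).m + 1)).2 c i ?_
  · rw [node, h]
    have h1 : (2 * n + b.toNat) / 2 = n := by cases b <;> simp <;> omega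
    have h2 : decide ((2 * n + b.toNat) % 2 = 1) = b := by cases b <;> simp <;> omega
    simp only [h1, h2]
  · have := (node_mono P hP).monotone (show n ≤ 2 * n + b.toNat by omega)
    omega

def idx (y : Cantor) : ℕ → ℕ
  | 0 => 0
  | k + 1 => child (idx y k) (y k)

lemma le_idx (y : Cantor) (k : ℕ) : k ≤ idx y k := by
  induction k with
  | zero => simp
  | succ k ih => rw [idx, child]; omega

lemma idx_congr (y y' : Cantor) (k : ℕ) (h : ∀ i < k, y i = y' i) : idx y k = idx y' k := by
  induction k with
  | zero => rfl
  | succ k ih => rw [idx, idx, ih (fun i hi => h i (by omega)), h k (by omega)]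

lemma idx_continuous (k : ℕ) : Continuous fun y => idx y k := by
  induction k with
  | zero => exact continuous_const
  | succ k ih =>
    have : (fun y => idx y (k+1)) =
      (fun p : ℕ × Bool => child p.1 p.2) ∘ fun y : Cantor => (idx y k, y k) := rfl
    rw [this]
    exact continuous_of_discreteTopology.comp (ih.prodMk (continuous_apply k))

noncomputable def lim (P : Set Cantor) (hP : PerfectSet P) (y : Cantor) : Cantor :=
  fun j => (node P hP (idx y j)).a (y j) j

lemma le_m (P : Set Cantor) (hP : PerfectSet P) (y : Cantor) (k : ℕ) :
    k ≤ (node P hP (idx y k)).m :=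
  (le_idx y k).trans (node_mono P hP).le_apply

lemma step_agree (P : Set Cantor) (hP : PerfectSet P) (y : Cantor) (k l : ℕ) (i : ℕ)
    (hi : i ≤ (node P hP (idx y k)).m) :
    (node P hP (idx y (k + l))).a (y (k + l)) i = (node P hP (idx y k)).a (y k) i := by
  induction l with
  | zero => rfl
  | succ l ih =>
    rw [← ih, ← add_assoc, idx, node_child]
    refine hi.trans ((node_mono P hP).monotone ?_)
    clear ih
    induction l with
    | zero => rfl
    | succ l ih => refine ih.trans ?_; rw [← add_assoc, idx, child]; omega

lemma lim_agree (P : Set Cantor) (hP : PerfectSet P) (y : Cantor) (k : ℕ) (i : ℕ)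
    (hi : i ≤ (node P hP (idx y k)).m) :
    lim P hP y i = (node P hP (idx y k)).a (y k) i := by
  unfold lim
  rcases le_total k i with h | h
  · obtain ⟨l, rfl⟩ := Nat.exists_eq_add_of_le h
    exact step_agree P hP y k l _ hi
  · obtain ⟨l, rfl⟩ := Nat.exists_eq_add_of_le h
    exact (step_agree P hP y i l i (le_m P hP y i)).symm

lemma lim_mem (P : Set Cantor) (hP : PerfectSet P) (y : Cantor) : lim P hP y ∈ P := by
  have ht : Filter.Tendsto (fun k => (node P hP (idx y k)).a (y k)) Filter.atTop
      (nhds (lim P hP y)) := by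
    rw [tendsto_pi_nhds]
    intro i
    refine tendsto_const_nhds.congr' ?_
    filter_upwards [Filter.eventually_ge_atTop i] with n hn
    exact lim_agree P hP y n i (hn.trans (le_m P hP y n))
  exact hP.1.closed.mem_of_tendsto ht (Filter.Eventually.of_forall fun k => (node P hP _).mem _)

lemma lim_continuous (P : Set Cantor) (hP : PerfectSet P) : Continuous (lim P hP) := by
  refine continuous_pi fun j => ?_
  have : (fun y => lim P hP y j) =
      (fun p : ℕ × Bool => (node P hP p.1).a p.2 j) ∘ fun y : Cantor => (idx y j, y j) := rfl
  rw [this]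
  exact continuous_of_discreteTopology.comp ((idx_continuous j).prodMk (continuous_apply j))

/-- distinct branches: they first differ at the level of a node -/
lemma lim_ne (P : Set Cantor) (hP : PerfectSet P) (y y' : Cantor) (h : y ≠ y') :
    ∃ n, lim P hP y (node P hP n).m ≠ lim P hP y' (node P hP n).m ∧
      (∀ i < (node P hP n).m, lim P hP y i = (node P hP n).a false i) ∧
      (∀ i < (node P hP n).m, lim P hP y' i = (node P hP n).a false i) := by
  classical
  have hd : ∃ m, y m ≠ y' m := Function.ne_iff.1 h
  have hm := Nat.find_spec hd
  have hlt : ∀ i < Nat.find hd, y i = y' i := fun i hi => by simpa using Nat.find_min hd hi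
  set k := Nat.find hd
  have he := idx_congr y y' k hlt
  refine ⟨idx y k, ?_, ?_, ?_⟩
  · rw [lim_agree P hP y k _ le_rfl, lim_agree P hP y' k _ (by rw [he]), ← he,
      (node P hP _).val, (node P hP _).val]
    exact hm
  · intro i hi
    rw [lim_agree P hP y k _ hi.le]
    exact (node P hP _).agree _ _ i hi
  · intro i hi
    rw [lim_agree P hP y' k _ (by rw [← he]; exact hi.le), ← he]
    exact (node P hP _).agree _ _ i hi

lemma lim_inj (P : Set Cantor) (hP : PerfectSet P) : Function.Injective (lim P hP) := by
  intro y y' h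
  by_contra hne
  obtain ⟨n, hn, _⟩ := lim_ne P hP y y' hne
  exact hn (by rw [h])

/-- translate -/
def tr (S : Set Cantor) (z : Cantor) : Set Cantor := {y | cAdd y z ∈ S}

def ThinS (Q : Set Cantor) : Prop := ∀ z w, z ≠ w → (tr Q z ∩ tr Q w).Countable

lemma cAdd_assoc (x y z : Cantor) : cAdd (cAdd x y) z = cAdd x (cAdd y z) := by
  funext n; simp [cAdd]
lemma cAdd_comm (x y : Cantor) : cAdd x y = cAdd y x := by
  funext n; simp [cAdd, Bool.xor_comm]
lemma cAdd_cancel (x y : Cantor) : cAdd (cAdd x y) y = x := by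
  funext n; simp [cAdd]
lemma cAdd_inj (z : Cantor) : Function.Injective fun y => cAdd y z := by
  intro a b h
  have := congrArg (fun y => cAdd y z) h
  simpa [cAdd_cancel] using this
lemma cAdd_cont (z : Cantor) : Continuous fun y => cAdd y z := by
  refine continuous_pi fun j => ?_
  exact (continuous_of_discreteTopology (f := fun b : Bool => xor b (z j))).comp (continuous_apply j)

lemma exists_thin (P : Set Cantor) (hP : PerfectSet P) :
    ∃ Q, PerfectSet Q ∧ Q ⊆ P ∧ ThinS Q := by
  refine ⟨Set.range (lim P hP), range_perfect _ (lim_continuous P hP) (lim_inj P hP), ?_, ?_⟩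
  · rintro _ ⟨y, rfl⟩; exact lim_mem P hP y
  intro z w hzw
  obtain ⟨K, hK⟩ := Function.ne_iff.1 hzw
  apply Set.Finite.countable
  refine Set.Finite.of_injOn (f := fun (x : Cantor) (i : Fin (K + 1)) => x i)
    (t := Set.univ) (fun _ _ => Set.mem_univ _) ?_ Set.finite_univ
  rintro x ⟨⟨y1, h1⟩, ⟨y2, h2⟩⟩ x' ⟨⟨y1', h1'⟩, ⟨y2', h2'⟩⟩ hxx
  by_contra hne
  have hxx : ∀ i ≤ K, x i = x' i := fun i hi => congrFun hxx ⟨i, by omega⟩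
  have hy1 : y1 ≠ y1' := by
    rintro rfl; exact hne (cAdd_inj z (h1.symm.trans h1'))
  have hy2 : y2 ≠ y2' := by
    rintro rfl; exact hne (cAdd_inj w (h2.symm.trans h2'))
  obtain ⟨n, hn, ha, hb⟩ := lim_ne P hP _ _ hy1
  obtain ⟨n', hn', ha', hb'⟩ := lim_ne P hP _ _ hy2
  rw [h1, h1'] at hn
  rw [h2, h2'] at hn'
  rw [h1] at ha
  rw [h1'] at hb
  rw [h2] at ha'
  rw [h2'] at hb'
  have hnn : (node P hP n).m = (node P hP n').m := by
    rcases lt_trichotomy (node P hP n).m (node P hP n').m with h | h | h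
    · have e := (ha' _ h).trans (hb' _ h).symm
      exfalso; apply hn; simpa [cAdd] using e
    · exact h
    · have e := (ha _ h).trans (hb _ h).symm
      exfalso; apply hn'; simpa [cAdd] using e
  have : n = n' := (node_mono P hP).injective hnn
  subst this
  have hlt : K < (node P hP n).m := by
    by_contra hcon
    apply hn
    simp [cAdd, hxx _ (not_lt.1 hcon)]
  have e := (ha _ hlt).trans (ha' _ hlt).symm
  apply hK
  simpa [cAdd] using e

lemma null_of_small (Y : Set Cantor)
    (h : ∀ P, PerfectSet P → ∃ R, PerfectSet R ∧ R ⊆ P ∧ #(R ∩ Y : Set Cantor) < Cardinal.continuum) :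
    MarczewskiNull Y := by
  intro P hP
  obtain ⟨R, hR, hRP, hc⟩ := h P hP
  let j : Cantor → Cantor → Cantor := fun w v n => if n % 2 = 0 then w (n / 2) else v (n / 2)
  have hj0 : ∀ w v n, j w v (2 * n) = w n := by intro w v n; simp [j]
  have hj1 : ∀ w v n, j w v (2 * n + 1) = v n := by
    intro w v n; simp [j, show (2 * n + 1) / 2 = n by omega]
  have hjc : ∀ w, Continuous (j w) := by
    intro w
    refine continuous_pi fun n => ?_
    by_cases hn : n % 2 = 0
    · simp only [j, hn, if_true]; exact continuous_const
    · simp only [j, hn, if_false]; exact continuous_apply _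
  have hji : ∀ w, Function.Injective (j w) := by
    intro w v v' h
    funext n
    rw [← hj1 w v, h, hj1]
  have hex : ∃ w, ∀ v, lim R hR (j w v) ∉ Y := by
    by_contra! hcon
    choose v hv using hcon
    have : #Cantor ≤ #(R ∩ Y : Set Cantor) := by
      refine mk_le_of_injective (f := fun w => ⟨lim R hR (j w (v w)), lim_mem R hR _, hv w⟩) ?_
      intro w w' hww
      have := lim_inj R hR (Subtype.ext_iff.1 hww)
      funext n
      rw [← hj0 w (v w), this, hj0]
    have h2 : #Cantor = Cardinal.continuum := by simp [Cantor]
    rw [h2] at this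
    exact absurd hc (not_lt.2 this)
  obtain ⟨w, hw⟩ := hex
  refine ⟨Set.range fun v => lim R hR (j w v), range_perfect _
    ((lim_continuous R hR).comp (hjc w)) ((lim_inj R hR).comp (hji w)), ?_, ?_⟩
  · rintro _ ⟨v, rfl⟩; exact hRP (lim_mem R hR _)
  · ext x; constructor
    · rintro ⟨⟨v, rfl⟩, hy⟩; exact (hw v hy).elim
    · simp

lemma mk_cantor : #Cantor = Cardinal.continuum := by simp [Cantor]

lemma mk_tr (X : Set Cantor) (z : Cantor) : #(tr X z) = #X := by
  refine mk_congr ⟨fun y => ⟨cAdd y.1 z, y.2⟩, fun x => ⟨cAdd x.1 z, ?_⟩, ?_, ?_⟩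
  · show cAdd (cAdd x.1 z) z ∈ X
    rw [cAdd_cancel]; exact x.2
  · intro y; simp [cAdd_cancel]
  · intro y; simp [cAdd_cancel]

lemma mk_inter_tr_le (Q X : Set Cantor) (z : Cantor) :
    #(Q ∩ tr X z : Set Cantor) ≤ #(X ∩ tr Q z : Set Cantor) := by
  refine mk_le_of_injective (f := fun y => ⟨cAdd y.1 z, y.2.2, ?_⟩) ?_
  · show cAdd (cAdd y.1 z) z ∈ Q
    rw [cAdd_cancel]; exact y.2.1
  · intro a b h
    exact Subtype.ext (cAdd_inj z (Subtype.ext_iff.1 h))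

lemma core (X : Set Cantor) (hX : #X = Cardinal.continuum) (A : Cantor → Set (Set Cantor))
    (h1 : ∀ z, #(tr X z ∩ ⋃₀ A z : Set Cantor) < Cardinal.continuum)
    (h2 : ∀ P, PerfectSet P → ∃ R, PerfectSet R ∧ R ⊆ P ∧
      #{z | R ∉ A z} < Cardinal.continuum) :
    ∃ Y : Set Cantor, MarczewskiNull Y ∧ setAdd X Y = Set.univ := by
  have hy : ∀ z, ∃ y ∈ tr X z, ∀ R ∈ A z, y ∉ R := by
    intro z
    by_contra! hcon
    have hsub : tr X z ⊆ tr X z ∩ ⋃₀ A z := by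
      intro y hy
      obtain ⟨R, hR, hyR⟩ := hcon y hy
      exact ⟨hy, R, hR, hyR⟩
    have := (mk_le_mk_of_subset hsub).trans_lt (h1 z)
    rw [mk_tr, hX] at this
    exact lt_irrefl _ this
  choose y hy hyA using hy
  refine ⟨Set.range y, null_of_small _ ?_, ?_⟩
  · intro P hP
    obtain ⟨R, hR, hRP, hc⟩ := h2 P hP
    refine ⟨R, hR, hRP, lt_of_le_of_lt ?_ hc⟩
    have : R ∩ Set.range y ⊆ y '' {z | R ∉ A z} := by
      rintro _ ⟨hm, z, rfl⟩
      exact ⟨z, fun h => hyA z R h hm, rfl⟩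
    exact (mk_le_mk_of_subset this).trans mk_image_le
  · rw [Set.eq_univ_iff_forall]
    intro z
    refine ⟨cAdd (y z) z, hy z, y z, ⟨z, rfl⟩, ?_⟩
    rw [cAdd_comm (y z) z, cAdd_cancel]

lemma mk_perf : #{P : Set Cantor // PerfectSet P} ≤ Cardinal.continuum := by
  have hB := TopologicalSpace.isBasis_countableBasis Cantor
  have : #{P : Set Cantor // PerfectSet P} ≤ #(Set (TopologicalSpace.countableBasis Cantor)) := by
    refine mk_le_of_injective (f := fun P => {b | b.1 ∩ P.1 = ∅}) ?_
    have key : ∀ P P' : {P : Set Cantor // PerfectSet P},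
        {b : TopologicalSpace.countableBasis Cantor | b.1 ∩ P.1 = ∅} ⊆ {b | b.1 ∩ P'.1 = ∅} →
        P'.1 ⊆ P.1 := by
      intro P P' h x hx
      by_contra hxP
      obtain ⟨b, hb, hxb, hbP⟩ := hB.exists_subset_of_mem_open (show x ∈ P.1ᶜ from hxP)
        P.2.1.closed.isOpen_compl
      have h3 : (⟨b, hb⟩ : TopologicalSpace.countableBasis Cantor) ∈
          {b : TopologicalSpace.countableBasis Cantor | b.1 ∩ P.1 = ∅} := by
        ext w; constructor
        · rintro ⟨h1, h2⟩; exact (hbP h1 h2).elim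
        · simp
      have h4 : b ∩ P'.1 = ∅ := h h3
      have : x ∈ b ∩ P'.1 := ⟨hxb, hx⟩
      rw [h4] at this
      exact this
    intro P P' h
    exact Subtype.ext (Set.Subset.antisymm (key P' P h.symm.subset) (key P P' h.subset))
  refine this.trans ?_
  rw [mk_set, ← two_power_aleph0]
  exact power_le_power_left two_ne_zero
    (mk_le_aleph0_iff.2 (TopologicalSpace.countable_countableBasis Cantor).to_subtype)

abbrev W : Type := Cardinal.continuum.{0}.ord.ToType

lemma mk_W : #W = Cardinal.continuum := by simp [W]

lemma Iio_lt (w : W) : #(Set.Iio w) < Cardinal.continuum := by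
  have := mk_Iio_lt w (by simp [W])
  rwa [mk_W] at this

lemma Iic_lt (w : W) : #(Set.Iic w) < Cardinal.continuum := by
  rw [← Set.Iio_insert]
  refine (mk_insert_le).trans_lt (add_lt_of_lt aleph0_le_continuum (Iio_lt w) ?_)
  exact one_lt_aleph0.trans_le aleph0_le_continuum

lemma exists_Iio (κ : Cardinal) (h : κ < Cardinal.continuum) : ∃ w : W, κ ≤ #(Set.Iio w) := by
  have h' : κ.ord < Ordinal.type (α := W) (· < ·) := by
    rw [Ordinal.type_toType]; exact ord_lt_ord.2 h
  refine ⟨Ordinal.enum (α := W) (· < ·) ⟨κ.ord, h'⟩, ?_⟩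
  have := Ordinal.typein_enum (α := W) (· < ·) h'
  have h2 := congrArg Ordinal.card this
  rw [card_ord] at h2
  exact h2.symm.le

lemma few_small_union {ι : Type} (t : ι → Set Cantor) (κ : Cardinal.{0}) (hι : #ι < Cardinal.continuum)
    (hκ : κ < Cardinal.continuum) (h : ∀ i, #(t i) ≤ κ) : #(⋃ i, t i) < Cardinal.continuum :=
  (mk_iUnion_le t).trans_lt (mul_lt_of_lt aleph0_le_continuum hι ((ciSup_le' h).trans_lt hκ))

lemma main_star (X : Set Cantor) (hX : #X = Cardinal.continuum)
    (h : ∀ P, PerfectSet P → ∃ R, PerfectSet R ∧ R ⊆ P ∧ ∃ κ < Cardinal.continuum,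
      #{z | ¬ #(R ∩ tr X z : Set Cantor) ≤ κ} < Cardinal.continuum) :
    ∃ Y : Set Cantor, MarczewskiNull Y ∧ setAdd X Y = Set.univ := by
  obtain ⟨e⟩ : Nonempty (Cantor ≃ W) := Cardinal.eq.1 (mk_cantor.trans mk_W.symm)
  obtain ⟨f⟩ : Nonempty ({P : Set Cantor // PerfectSet P} ↪ W) := by
    have := mk_perf
    rwa [← mk_W] at this
  refine core X hX (fun z => {R | ∃ h : PerfectSet R, f ⟨R, h⟩ < e z ∧
    #(R ∩ tr X z : Set Cantor) ≤ max ℵ₀ #(Set.Iio (e z))}) ?_ ?_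
  · intro z
    set A : Set (Set Cantor) := {R | ∃ h : PerfectSet R, f ⟨R, h⟩ < e z ∧
      #(R ∩ tr X z : Set Cantor) ≤ max ℵ₀ #(Set.Iio (e z))}
    have hA : #A ≤ #(Set.Iio (e z)) := by
      refine mk_le_of_injective (f := fun R => ⟨f ⟨R.1, R.2.choose⟩, R.2.choose_spec.1⟩) ?_
      intro R R' h
      have := f.injective (Subtype.ext_iff.1 h)
      have h3 : R.1 = R'.1 := by simpa using this
      exact Subtype.ext h3
    have he : tr X z ∩ ⋃₀ A = ⋃ R : A, (R.1 ∩ tr X z) := by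
      rw [Set.sUnion_eq_iUnion, Set.inter_iUnion]
      simp only [Set.inter_comm]
    rw [he]
    refine few_small_union _ _ (hA.trans_lt (Iio_lt _)) (max_lt aleph0_lt_continuum (Iio_lt (e z))) ?_
    intro R; exact R.2.choose_spec.2
  · intro P hP
    obtain ⟨R, hR, hRP, κ, hκ, hc⟩ := h P hP
    refine ⟨R, hR, hRP, ?_⟩
    obtain ⟨w, hw⟩ := exists_Iio κ hκ
    have hsub : {z | R ∉ {R | ∃ h : PerfectSet R, f ⟨R, h⟩ < e z ∧
        #(R ∩ tr X z : Set Cantor) ≤ max ℵ₀ #(Set.Iio (e z))}} ⊆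
        (e ⁻¹' Set.Iic (max (f ⟨R, hR⟩) w)) ∪ {z | ¬ #(R ∩ tr X z : Set Cantor) ≤ κ} := by
      intro z hz
      by_contra hcon
      simp only [Set.mem_union, Set.mem_preimage, Set.mem_Iic, not_or, not_le, Set.mem_setOf_eq,
        not_lt, max_lt_iff] at hcon
      refine hz ⟨hR, hcon.1.1, hcon.2.trans (hw.trans (le_max_of_le_right ?_))⟩
      exact mk_le_mk_of_subset (Set.Iio_subset_Iio hcon.1.2.le)
    refine (mk_le_mk_of_subset hsub).trans_lt ((mk_union_le _ _).trans_lt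
      (add_lt_of_lt aleph0_le_continuum ?_ hc))
    exact (mk_preimage_of_injective _ _ e.injective).trans_lt (Iic_lt _)

lemma main_reg (X : Set Cantor) (hX : #X = Cardinal.continuum)
    (hreg : Cardinal.continuum.{0}.IsRegular)
    (h : ∀ P, PerfectSet P → ∃ R, PerfectSet R ∧ R ⊆ P ∧
      ∀ z, #(R ∩ tr X z : Set Cantor) < Cardinal.continuum) :
    ∃ Y : Set Cantor, MarczewskiNull Y ∧ setAdd X Y = Set.univ := by
  obtain ⟨e⟩ : Nonempty (Cantor ≃ W) := Cardinal.eq.1 (mk_cantor.trans mk_W.symm)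
  obtain ⟨f⟩ : Nonempty ({P : Set Cantor // PerfectSet P} ↪ W) := by
    have := mk_perf
    rwa [← mk_W] at this
  refine core X hX (fun z => {R | ∃ h : PerfectSet R, f ⟨R, h⟩ < e z ∧
    #(R ∩ tr X z : Set Cantor) < Cardinal.continuum}) ?_ ?_
  · intro z
    set A : Set (Set Cantor) := {R | ∃ h : PerfectSet R, f ⟨R, h⟩ < e z ∧
      #(R ∩ tr X z : Set Cantor) < Cardinal.continuum}
    have hA : #A ≤ #(Set.Iio (e z)) := by
      refine mk_le_of_injective (f := fun R => ⟨f ⟨R.1, R.2.choose⟩, R.2.choose_spec.1⟩) ?_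
      intro R R' h
      have := f.injective (Subtype.ext_iff.1 h)
      have h3 : R.1 = R'.1 := by simpa using this
      exact Subtype.ext h3
    have he : tr X z ∩ ⋃₀ A = ⋃ R : A, (R.1 ∩ tr X z) := by
      rw [Set.sUnion_eq_iUnion, Set.inter_iUnion]
      simp only [Set.inter_comm]
    rw [he]
    refine (card_iUnion_lt_iff_forall_of_isRegular hreg (hA.trans_lt (Iio_lt _))).2 ?_
    intro R; exact R.2.choose_spec.2
  · intro P hP
    obtain ⟨R, hR, hRP, hc⟩ := h P hP
    refine ⟨R, hR, hRP, ?_⟩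
    have hsub : {z | R ∉ {R | ∃ h : PerfectSet R, f ⟨R, h⟩ < e z ∧
        #(R ∩ tr X z : Set Cantor) < Cardinal.continuum}} ⊆
        (e ⁻¹' Set.Iic (f ⟨R, hR⟩)) := by
      intro z hz
      by_contra hcon
      exact hz ⟨hR, not_le.1 hcon, hc z⟩
    refine (mk_le_mk_of_subset hsub).trans_lt ?_
    exact (mk_preimage_of_injective _ _ e.injective).trans_lt (Iic_lt _)

lemma case_one (X Q I : Set Cantor) (hQ : PerfectSet Q) (hthin : ThinS Q)
    (hI : #I < Cardinal.continuum) (hXQ : X ⊆ ⋃ i : I, tr Q i) (hX : #X = Cardinal.continuum) :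
    ∃ Y : Set Cantor, MarczewskiNull Y ∧ setAdd X Y = Set.univ := by
  have hcover : ∀ R z, #{i : I | ¬ (R ∩ tr Q (cAdd z i)).Countable} = 0 →
      #(R ∩ tr X z : Set Cantor) ≤ #I * ℵ₀ := by
    intro R z h0
    have h0 : ∀ i : I, (R ∩ tr Q (cAdd z i)).Countable := by
      intro i
      by_contra hc
      rw [mk_eq_zero_iff] at h0
      exact h0.false ⟨i, hc⟩
    have hsub : R ∩ tr X z ⊆ ⋃ i : I, (R ∩ tr Q (cAdd z i)) := by
      rintro y ⟨hyR, hyX⟩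
      obtain ⟨i, hi⟩ := Set.mem_iUnion.1 (hXQ hyX)
      refine Set.mem_iUnion.2 ⟨i, hyR, ?_⟩
      have : cAdd (cAdd y z) i ∈ Q := hi
      rwa [cAdd_assoc] at this
    refine (mk_le_mk_of_subset hsub).trans ((mk_iUnion_le _).trans ?_)
    gcongr
    exact ciSup_le' fun i => mk_le_aleph0_iff.2 (h0 i).to_subtype
  have hκ : #I * ℵ₀ < Cardinal.continuum :=
    mul_lt_of_lt aleph0_le_continuum hI aleph0_lt_continuum
  refine main_star X hX ?_
  intro P hP
  by_cases hc : ∀ z, (P ∩ tr Q z).Countable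
  · refine ⟨P, hP, subset_rfl, #I * ℵ₀, hκ, ?_⟩
    have : {z | ¬ #(P ∩ tr X z : Set Cantor) ≤ #I * ℵ₀} = ∅ := by
      ext z
      simp only [Set.mem_setOf_eq, Set.mem_empty_iff_false, iff_false, not_not]
      apply hcover
      rw [mk_eq_zero_iff]
      exact ⟨fun i => i.2 (hc _)⟩
    rw [this]
    simpa using continuum_pos
  · push Not at hc
    obtain ⟨z₀, hz₀⟩ := hc
    obtain ⟨R, hRp, hRn, hR⟩ := exists_perfect_nonempty_of_isClosed_of_not_countable
      (hP.1.closed.inter (hQ.1.closed.preimage (cAdd_cont z₀))) hz₀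
    refine ⟨R, ⟨hRp, hRn⟩, hR.trans Set.inter_subset_left, #I * ℵ₀, hκ, ?_⟩
    have hsub : {z | ¬ #(R ∩ tr X z : Set Cantor) ≤ #I * ℵ₀} ⊆ (fun i => cAdd z₀ i) '' I := by
      intro z hz
      by_contra hcon
      apply hz
      apply hcover
      rw [mk_eq_zero_iff]
      refine ⟨fun i => i.2 ?_⟩
      have hne : z₀ ≠ cAdd z i.1 := by
        intro h
        apply hcon
        refine ⟨i.1, i.1.2, ?_⟩
        simp only [h, cAdd_cancel]
      refine (hthin _ _ hne).mono ?_
      intro y hy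
      exact ⟨(hR hy.1).2, hy.2⟩
    exact ((mk_le_mk_of_subset hsub).trans mk_image_le).trans_lt hI

theorem stmt10 (X : Set Cantor) (hX : #X = Cardinal.continuum) :
    ∃ Y : Set Cantor, MarczewskiNull Y ∧ setAdd X Y = Set.univ := by
  by_cases h1 : ∃ Q I : Set Cantor, PerfectSet Q ∧ ThinS Q ∧ #I < Cardinal.continuum ∧
      #(X ∩ ⋃ i : I, tr Q i : Set Cantor) = Cardinal.continuum
  · obtain ⟨Q, I, hQ, ht, hI, hc⟩ := h1
    obtain ⟨Y, hY, hXY⟩ := case_one _ Q I hQ ht hI Set.inter_subset_right hc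
    refine ⟨Y, hY, Set.eq_univ_of_univ_subset ?_⟩
    rw [← hXY]
    exact Set.image2_subset_right Set.inter_subset_left
  · have h2 : ∀ Q I : Set Cantor, PerfectSet Q → ThinS Q → #I < Cardinal.continuum →
        #(X ∩ ⋃ i : I, tr Q i : Set Cantor) < Cardinal.continuum := by
      intro Q I hQ ht hI
      refine lt_of_le_of_ne ?_ fun h => h1 ⟨Q, I, hQ, ht, hI, h⟩
      rw [← hX]
      exact mk_le_mk_of_subset Set.inter_subset_left
    have hle : ∀ (Q I : Set Cantor) (z : Cantor), z ∈ I → #(Q ∩ tr X z : Set Cantor) ≤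
        #(X ∩ ⋃ i : I, tr Q i : Set Cantor) := by
      intro Q I z hz
      refine (mk_inter_tr_le Q X z).trans (mk_le_mk_of_subset ?_)
      exact Set.inter_subset_inter_right _ (Set.subset_iUnion (fun i : I => tr Q i) ⟨z, hz⟩)
    rcases isRegular_or_isSingular aleph0_le_continuum.{0} with hreg | hsing
    · refine main_reg X hX hreg ?_
      intro P hP
      obtain ⟨Q, hQ, hQP, ht⟩ := exists_thin P hP
      refine ⟨Q, hQ, hQP, fun z => (hle Q {z} z rfl).trans_lt (h2 Q {z} hQ ht ?_)⟩
      rw [mk_singleton]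
      exact one_lt_aleph0.trans_le aleph0_le_continuum
    · refine main_star X hX ?_
      intro P hP
      obtain ⟨Q, hQ, hQP, ht⟩ := exists_thin P hP
      refine ⟨Q, hQ, hQP, ?_⟩
      by_contra! hcon
      have hz : ∀ w : W, ∃ z, #(Set.Iio w) < #(Q ∩ tr X z : Set Cantor) := by
        intro w
        by_contra! hno
        have := hcon _ (Iio_lt w)
        have he : {z | #(Set.Iio w) < #(Q ∩ tr X z : Set Cantor)} = ∅ := by
          ext z; simpa using hno z
        simp only [he, mk_emptyCollection] at this
        exact absurd this (not_le.2 continuum_pos)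
      choose z hz using hz
      obtain ⟨s, hs, hsc⟩ := Order.exists_cof_eq W
      have hlt : #(z '' s) < Cardinal.continuum := by
        refine mk_image_le.trans_lt ?_
        rw [hsc, Ordinal.cof_toType]
        exact hsing.cof_ord_lt
      have hT := h2 Q (z '' s) hQ ht hlt
      obtain ⟨w, hw⟩ := exists_Iio _ hT
      obtain ⟨v, hv, hwv⟩ := hs w
      have h3 := hle Q (z '' s) (z v) ⟨v, hv, rfl⟩
      have h4 : #(Set.Iio w) ≤ #(Set.Iio v) := mk_le_mk_of_subset (Set.Iio_subset_Iio hwv)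
      exact absurd (((hz v).trans_le h3).trans_le (hw.trans h4)) (lt_irrefl _)
end

section
/- Assuming CH, the Marczewski Borel Conjecture holds: a set X ⊆ 2^ω is s₀-shiftable if and only if X is countable. -/
open Cardinal

open Topology

namespace MBC

theorem cAdd_comm (x y : Cantor) : cAdd x y = cAdd y x := by
  funext n; simp [cAdd, Bool.xor_comm]

theorem cAdd_assoc (x y z : Cantor) : cAdd (cAdd x y) z = cAdd x (cAdd y z) := by
  funext n; simp [cAdd]

theorem cAdd_cancel (x y : Cantor) : cAdd (cAdd x y) y = x := by
  funext n; simp [cAdd]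

theorem cAdd_inj (t : Cantor) : Function.Injective (fun x => cAdd x t) := by
  intro x y h
  have := congrArg (fun w => cAdd w t) h
  simpa [cAdd_cancel] using this

theorem continuous_cAdd (t : Cantor) : Continuous (fun x => cAdd x t) := by
  refine continuous_pi fun n => ?_
  exact (continuous_of_discreteTopology (f := fun b : Bool => xor b (t n))).comp
    (continuous_apply n)

theorem nhds_agree {x : Cantor} {U : Set Cantor} (hU : U ∈ 𝓝 x) :
    ∃ n, ∀ y : Cantor, (∀ i < n, y i = x i) → y ∈ U := by
  obtain ⟨t, ⟨z, n, rfl⟩, hx, hs⟩ :=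
    (PiNat.isTopologicalBasis_cylinders (fun _ : ℕ => Bool)).mem_nhds_iff.1 hU
  refine ⟨n, fun y hy => hs ?_⟩
  rw [PiNat.mem_cylinder_iff] at hx ⊢
  intro i hi
  rw [hy i hi, hx i hi]

theorem agree_nhds (x : Cantor) (n : ℕ) : {y : Cantor | ∀ i < n, y i = x i} ∈ 𝓝 x :=
  (PiNat.isOpen_cylinder (fun _ : ℕ => Bool) x n).mem_nhds (PiNat.self_mem_cylinder x n)

theorem perf_sub {C : Set Cantor} (hC : IsClosed C) (h : ¬ C.Countable) :
    ∃ Q, PerfectSet Q ∧ Q ⊆ C := by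
  obtain ⟨D, h1, h2, h3⟩ := exists_perfect_nonempty_of_isClosed_of_not_countable hC h
  exact ⟨D, ⟨h1, h2⟩, h3⟩

theorem not_countable_univ : ¬ (Set.univ : Set Cantor).Countable := by
  rw [Set.countable_univ_iff, ← Cardinal.mk_le_aleph0_iff, not_le]
  simpa using Cardinal.cantor ℵ₀

theorem perf_inj {P : Set Cantor} (hP : PerfectSet P) :
    ∃ f : Cantor → Cantor, Set.range f ⊆ P ∧ Continuous f ∧ Function.Injective f := by
  letI := TopologicalSpace.upgradeIsCompletelyMetrizable Cantor
  exact Perfect.exists_nat_bool_injection hP.1 hP.2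

theorem perf_unc {P : Set Cantor} (hP : PerfectSet P) : ¬ P.Countable := by
  intro hc
  obtain ⟨f, h1, h2, h3⟩ := perf_inj hP
  have := (hc.mono h1)
  rw [← Set.image_univ] at this
  exact not_countable_univ (Set.countable_of_injective_of_countable_image h3.injOn this)

/-- interleaving -/
def slice (a : Cantor) : Set Cantor := {x | ∀ n, x (2 * n) = a n}

theorem slice_closed (a : Cantor) : IsClosed (slice a) := by
  have : slice a = ⋂ n, {x : Cantor | x (2 * n) = a n} := by ext; simp [slice]
  rw [this]
  exact isClosed_iInter fun n => isClosed_eq (continuous_apply _) continuous_const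

theorem slice_unc (a : Cantor) : ¬ (slice a).Countable := by
  intro h
  let g : Cantor → Cantor := fun b n => if n % 2 = 0 then a (n / 2) else b (n / 2)
  have hg : Function.Injective g := by
    intro b c hbc
    funext n
    have := congrFun hbc (2 * n + 1)
    have h1 : (2 * n + 1) % 2 = 1 := by omega
    have h2 : (2 * n + 1) / 2 = n := by omega
    simpa [g, h1, h2] using this
  have : (g '' Set.univ).Countable := h.mono (by
    rintro _ ⟨b, -, rfl⟩ n
    simp [g])
  exact not_countable_univ (Set.countable_of_injective_of_countable_image hg.injOn this)

theorem perf_avoid {P C : Set Cantor} (hP : PerfectSet P) (hC : C.Countable) :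
    ∃ Q, PerfectSet Q ∧ Q ⊆ P ∧ Q ∩ C = ∅ := by
  obtain ⟨f, h1, h2, h3⟩ := perf_inj hP
  have hpre : (f ⁻¹' C).Countable := hC.preimage_of_injOn h3.injOn
  have him : ((fun x : Cantor => fun n => x (2 * n)) '' (f ⁻¹' C)).Countable := hpre.image _
  obtain ⟨a, ha⟩ : ∃ a : Cantor, a ∉ ((fun x : Cantor => fun n => x (2 * n)) '' (f ⁻¹' C)) := by
    by_contra hcon
    push Not at hcon
    exact not_countable_univ (him.mono fun a _ => hcon a)
  have hcl : IsClosed (f '' slice a) := ((slice_closed a).isCompact.image h2).isClosed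
  have hun : ¬ (f '' slice a).Countable := fun h =>
    slice_unc a (Set.countable_of_injective_of_countable_image h3.injOn h)
  obtain ⟨Q, hQ, hQs⟩ := perf_sub hcl hun
  refine ⟨Q, hQ, fun x hx => ?_, ?_⟩
  · obtain ⟨y, -, rfl⟩ := hQs hx
    exact h1 ⟨y, rfl⟩
  · ext x
    simp only [Set.mem_inter_iff, Set.mem_empty_iff_false, iff_false, not_and]
    intro hx hxC
    obtain ⟨y, hy, rfl⟩ := hQs hx
    exact ha ⟨y, hxC, funext hy⟩

/-! ### Skew sets -/

def Diff (n : ℕ) (x y : Cantor) : Prop := (∀ i < n, x i = y i) ∧ x n ≠ y n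

theorem exists_diff {x y : Cantor} (h : x ≠ y) : ∃ n, Diff n x y := by
  classical
  have h' : ∃ n, x n ≠ y n := Function.ne_iff.1 h
  exact ⟨Nat.find h', fun i hi => by simpa using Nat.find_min h' hi, Nat.find_spec h'⟩

def Skew (S : Set Cantor) : Prop :=
  ∀ n, ∀ x ∈ S, ∀ y ∈ S, ∀ x' ∈ S, ∀ y' ∈ S, Diff n x y → Diff n x' y' → ∀ i < n, x i = x' i

theorem Skew.closure {S : Set Cantor} (h : Skew S) : Skew (closure S) := by
  have key : ∀ n, ∀ x ∈ _root_.closure S, ∃ y ∈ S, ∀ i < n + 1, y i = x i := by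
    intro n x hx
    obtain ⟨y, h1, h2⟩ := mem_closure_iff_nhds.1 hx _ (agree_nhds x (n + 1))
    exact ⟨y, h2, h1⟩
  intro n x hx y hy x' hx' y' hy' hd hd' i hi
  obtain ⟨u, hu, hu1⟩ := key n x hx
  obtain ⟨v, hv, hv1⟩ := key n y hy
  obtain ⟨u', hu', hu1'⟩ := key n x' hx'
  obtain ⟨v', hv', hv1'⟩ := key n y' hy'
  have e1 : Diff n u v := ⟨fun j hj => by
    rw [hu1 j (by omega), hv1 j (by omega), hd.1 j hj], by
    rw [hu1 n (by omega), hv1 n (by omega)]; exact hd.2⟩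
  have e2 : Diff n u' v' := ⟨fun j hj => by
    rw [hu1' j (by omega), hv1' j (by omega), hd'.1 j hj], by
    rw [hu1' n (by omega), hv1' n (by omega)]; exact hd'.2⟩
  have := h n u hu v hv u' hu' v' hv' e1 e2 i hi
  rwa [hu1 i (by omega), hu1' i (by omega)] at this

theorem skew_inter {Q : Set Cantor} (hQ : Skew Q) {s t : Cantor} (hst : s ≠ t) :
    {w | cAdd w s ∈ Q ∧ cAdd w t ∈ Q}.Countable := by
  obtain ⟨k, hk⟩ := Function.ne_iff.1 hst
  have : {w | cAdd w s ∈ Q ∧ cAdd w t ∈ Q}.Finite := by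
    refine Set.Finite.of_injOn (f := fun (w : Cantor) (i : Fin (k + 1)) => w i)
      (t := Set.univ) (fun _ _ => Set.mem_univ _) ?_ Set.finite_univ
    intro u hu v hv huv
    by_contra hne
    obtain ⟨n, hn1, hn2⟩ := exists_diff hne
    have hd : ∀ r, Diff n (cAdd u r) (cAdd v r) := fun r =>
      ⟨fun i hi => by simp [cAdd, hn1 i hi], by simpa [cAdd] using hn2⟩
    have hag := hQ n _ hu.1 _ hv.1 _ hu.2 _ hv.2 (hd s) (hd t)
    have hnk : k < n := by
      by_contra hcon
      exact hn2 (congrFun huv ⟨n, by omega⟩)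
    have := hag k hnk
    simp [cAdd] at this
    exact hk this
  exact this.countable

theorem skew_step {P F : Set Cantor} (hP : PerfectSet P) (hF : F.Finite) (hFP : F ⊆ P)
    (hS : Skew F) {x : Cantor} (hx : x ∈ F) (N : ℕ) :
    ∃ x' ∈ P, x' ≠ x ∧ (∀ i < N, x' i = x i) ∧ Skew (insert x' F) := by
  obtain ⟨M, hNM, hM⟩ : ∃ M, N ≤ M ∧ ∀ u ∈ F, ∀ v ∈ F, (∀ i < M, u i = v i) → u = v := by
    have : ∀ p : Cantor × Cantor, ∃ m, (∀ i < m, p.1 i = p.2 i) → p.1 = p.2 := by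
      intro p
      by_cases h : p.1 = p.2
      · exact ⟨0, fun _ => h⟩
      · obtain ⟨n, hn⟩ := exists_diff h
        exact ⟨n + 1, fun h => absurd (h n (by omega)) hn.2⟩
    choose m hm using this
    obtain ⟨B, hB⟩ := ((hF.prod hF).image m).bddAbove
    refine ⟨max N B, le_max_left _ _, fun u hu v hv h => hm (u, v) fun i hi => h i ?_⟩
    have := hB ⟨(u, v), ⟨hu, hv⟩, rfl⟩
    exact lt_of_lt_of_le hi (this.trans (le_max_right _ _))
  obtain ⟨x', ⟨hx1, hx2⟩, hx3⟩ := preperfect_iff_nhds.1 hP.1.acc x (hFP hx) _ (agree_nhds x M)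
  refine ⟨x', hx2, hx3, fun i hi => hx1 i (by omega), ?_⟩
  have hr : ∀ u ∈ insert x' F, ∃ r ∈ F, (∀ i < M, u i = r i) ∧ (u = r ∨ (u = x' ∧ r = x)) := by
    rintro u (rfl | hu)
    · exact ⟨x, hx, hx1, Or.inr ⟨rfl, rfl⟩⟩
    · exact ⟨u, hu, fun _ _ => rfl, Or.inl rfl⟩
  have key : ∀ n, ∀ u ∈ insert x' F, ∀ v ∈ insert x' F, Diff n u v →
      (n < M ∧ ∃ a ∈ F, ∃ b ∈ F, Diff n a b ∧ ∀ i < n, u i = a i) ∨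
      (M ≤ n ∧ ∀ i < n, u i = x i) := by
    intro n u hu v hv hd
    obtain ⟨a, ha, ha1, ha2⟩ := hr u hu
    obtain ⟨b, hb, hb1, hb2⟩ := hr v hv
    rcases lt_or_ge n M with h | h
    · refine Or.inl ⟨h, a, ha, b, hb, ⟨fun i hi => ?_, ?_⟩, fun i hi => ha1 i (by omega)⟩
      · rw [← ha1 i (by omega), ← hb1 i (by omega), hd.1 i hi]
      · rw [← ha1 n h, ← hb1 n h]; exact hd.2
    · refine Or.inr ⟨h, ?_⟩
      have hab : a = b := hM a ha b hb fun i hi => by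
        rw [← ha1 i hi, ← hb1 i hi, hd.1 i (by omega)]
      subst hab
      rcases ha2 with rfl | ⟨rfl, rfl⟩
      · rcases hb2 with rfl | ⟨rfl, rfl⟩
        · exact absurd rfl hd.2
        · exact fun _ _ => rfl
      · rcases hb2 with rfl | ⟨rfl, -⟩
        · exact hd.1
        · exact absurd rfl hd.2
  intro n u hu v hv u' hu' v' hv' hd hd' i hi
  rcases key n u hu v hv hd with ⟨h, a, ha, b, hb, hab, h1⟩ | ⟨h, h1⟩
  · rcases key n u' hu' v' hv' hd' with ⟨h', a', ha', b', hb', hab', h1'⟩ | ⟨h', h1'⟩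
    · rw [h1 i hi, h1' i hi]
      exact hS n a ha b hb a' ha' b' hb' hab hab' i hi
    · omega
  · rcases key n u' hu' v' hv' hd' with ⟨h', a', ha', b', hb', hab', h1'⟩ | ⟨h', h1'⟩
    · omega
    · rw [h1 i hi, h1' i hi]

def Good (P F : Set Cantor) : Prop := F.Finite ∧ F.Nonempty ∧ F ⊆ P ∧ Skew F

theorem skew_level {P F : Set Cantor} (hP : PerfectSet P) (hF : Good P F) (N : ℕ) :
    ∃ F', Good P F' ∧ F ⊆ F' ∧ ∀ x ∈ F, ∃ x' ∈ F', x' ≠ x ∧ ∀ i < N, x' i = x i := by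
  have : ∀ G : Set Cantor, G.Finite → G ⊆ F →
      ∃ F', Good P F' ∧ F ⊆ F' ∧ ∀ x ∈ G, ∃ x' ∈ F', x' ≠ x ∧ ∀ i < N, x' i = x i := by
    intro G hG
    induction G, hG using Set.Finite.induction_on with
    | empty => exact fun _ => ⟨F, hF, subset_rfl, by simp⟩
    | @insert a G haG hGf ih =>
      intro hs
      obtain ⟨F', hF', hsub, h⟩ := ih ((Set.subset_insert _ _).trans hs)
      obtain ⟨x', h1, h2, h3, h4⟩ := skew_step hP hF'.1 hF'.2.2.1 hF'.2.2.2
        (hsub (hs (Set.mem_insert a G))) N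
      refine ⟨insert x' F', ⟨hF'.1.insert _, Set.insert_nonempty _ _,
        Set.insert_subset h1 hF'.2.2.1, h4⟩, hsub.trans (Set.subset_insert _ _), ?_⟩
      rintro x (rfl | hx)
      · exact ⟨x', Set.mem_insert _ _, h2, h3⟩
      · obtain ⟨y, hy, hy'⟩ := h x hx
        exact ⟨y, Set.mem_insert_of_mem _ hy, hy'⟩
  exact this F hF.1 subset_rfl

theorem exists_skew {P : Set Cantor} (hP : PerfectSet P) :
    ∃ Q, PerfectSet Q ∧ Q ⊆ P ∧ Skew Q := by
  obtain ⟨x0, hx0⟩ := hP.2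
  have h0 : Good P {x0} := by
    refine ⟨Set.finite_singleton _, Set.singleton_nonempty _, by simpa using hx0, ?_⟩
    rintro n x rfl y rfl x' rfl y' rfl _ _ i _
    rfl
  choose! nx hn1 hn2 hn3 using fun (N : ℕ) (F : Set Cantor) (hF : Good P F) =>
    skew_level hP hF N
  let S : ℕ → Set Cantor := fun k => Nat.rec {x0} (fun k F => nx k F) k
  have hS : ∀ k, Good P (S k) := by
    intro k
    induction k with
    | zero => exact h0
    | succ k ih => exact hn1 k _ ih
  have hmono : Monotone S := monotone_nat_of_le_succ fun k => hn2 k _ (hS k)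
  have hskew : Skew (⋃ k, S k) := by
    intro n x hx y hy x' hx' y' hy'
    simp only [Set.mem_iUnion] at hx hy hx' hy'
    obtain ⟨a, ha⟩ := hx
    obtain ⟨b, hb⟩ := hy
    obtain ⟨c, hc⟩ := hx'
    obtain ⟨d, hd⟩ := hy'
    exact (hS (a + b + c + d)).2.2.2 n x (hmono (by omega) ha) y (hmono (by omega) hb)
      x' (hmono (by omega) hc) y' (hmono (by omega) hd)
  have hpre : Preperfect (⋃ k, S k) := by
    rw [preperfect_iff_nhds]
    intro x hx U hU
    obtain ⟨a, ha⟩ := Set.mem_iUnion.1 hx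
    obtain ⟨N, hN⟩ := nhds_agree hU
    obtain ⟨x', h1, h2, h3⟩ := hn3 (a + N) _ (hS (a + N)) x (hmono (by omega) ha)
    exact ⟨x', ⟨hN x' fun i hi => h3 i (by omega), Set.mem_iUnion.2 ⟨a + N + 1, h1⟩⟩, h2⟩
  refine ⟨closure (⋃ k, S k), ⟨hpre.perfect_closure, ?_⟩, ?_, hskew.closure⟩
  · exact ⟨x0, subset_closure (Set.mem_iUnion.2 ⟨0, rfl⟩)⟩
  · exact closure_minimal (Set.iUnion_subset fun k => (hS k).2.2.1) hP.1.closed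

/-! ### Reduction -/

theorem reduction {X : Set Cantor} (hX : ¬ X.Countable) :
    ∃ X' ⊆ X, ¬ X'.Countable ∧ ∀ P, PerfectSet P → ∃ R, PerfectSet R ∧ R ⊆ P ∧
      ∃ t : Cantor, ∀ z, z ≠ t → {x ∈ X' | cAdd x z ∈ R}.Countable := by
  by_cases hc : ∃ Q t0, PerfectSet Q ∧ Skew Q ∧ ¬ {x ∈ X | cAdd x t0 ∈ Q}.Countable
  · obtain ⟨Q, t0, hQ, hsk, hun⟩ := hc
    refine ⟨{x ∈ X | cAdd x t0 ∈ Q}, fun x hx => hx.1, hun, fun P hP => ?_⟩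
    by_cases ht : ∃ t, ¬ {w ∈ P | cAdd w t ∈ Q}.Countable
    · obtain ⟨t, ht⟩ := ht
      have hcl : IsClosed {w ∈ P | cAdd w t ∈ Q} :=
        hP.1.closed.inter (hQ.1.closed.preimage (continuous_cAdd t))
      obtain ⟨R, hR, hRs⟩ := perf_sub hcl ht
      refine ⟨R, hR, fun x hx => (hRs hx).1, cAdd t0 t, fun z hz => ?_⟩
      have hne : t0 ≠ cAdd z t := by
        rintro rfl
        exact hz (cAdd_cancel z t).symm
      refine (skew_inter hsk hne).mono ?_
      rintro x ⟨hx, hxz⟩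
      refine ⟨hx.2, ?_⟩
      rw [← cAdd_assoc]
      exact (hRs hxz).2
    · push Not at ht
      refine ⟨P, hP, subset_rfl, t0, fun z _ => ?_⟩
      refine Set.countable_of_injective_of_countable_image (cAdd_inj z).injOn
        ((ht (cAdd z t0)).mono ?_)
      rintro _ ⟨x, ⟨hx, hxz⟩, rfl⟩
      refine ⟨hxz, ?_⟩
      show cAdd (cAdd x z) (cAdd z t0) ∈ Q
      rw [← cAdd_assoc, cAdd_cancel]
      exact hx.2
  · push Not at hc
    refine ⟨X, subset_rfl, hX, fun P hP => ?_⟩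
    obtain ⟨Q, hQ, hQP, hsk⟩ := exists_skew hP
    exact ⟨Q, hQ, hQP, fun _ => false, fun z _ => hc Q z hQ hsk⟩

theorem closed_code : ∃ e : Cantor → Set Cantor, ∀ C, IsClosed C → ∃ c, e c = C := by
  classical
  obtain ⟨b, hbc, -, hb⟩ := TopologicalSpace.exists_countable_basis Cantor
  have hne : b.Nonempty := by
    obtain ⟨t, ht, -⟩ := hb.exists_subset_of_mem_open
      (Set.mem_univ (fun _ => false : Cantor)) isOpen_univ
    exact ⟨t, ht⟩
  obtain ⟨g, rfl⟩ := hbc.exists_eq_range hne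
  refine ⟨fun c => {x | ∀ n, c n = true → x ∉ g n}, fun C hC =>
    ⟨fun n => decide (g n ⊆ Cᶜ), ?_⟩⟩
  ext x
  simp only [decide_eq_true_eq, Set.mem_ofPred_eq]
  constructor
  · intro h
    by_contra hx
    obtain ⟨_, ⟨n, rfl⟩, h1, h2⟩ := hb.exists_subset_of_mem_open
      (show x ∈ Cᶜ from hx) hC.isOpen_compl
    exact h n h2 h1
  · intro hx n hn hxn
    exact hn hxn hx

theorem exists_order (hCH : Cardinal.continuum = Cardinal.aleph 1) :
    ∃ r : Cantor → Cantor → Prop, (∀ a, {b | r b a}.Countable) ∧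
      (∀ a, {b | ¬ r a b}.Countable) := by
  obtain ⟨r, wo, hr⟩ := Cardinal.exists_ord_eq Cantor
  have hcard : #Cantor = Cardinal.aleph 1 := by
    have h0 : (Cardinal.continuum.{0}) = Cardinal.aleph 1 := by
      apply Cardinal.lift_injective
      simpa using hCH
    rw [← h0]; simp
  have h1 : ∀ a, {b | r b a}.Countable := by
    intro a
    have := Cardinal.card_typein_lt (r := r) a hr
    rw [hcard, ← Cardinal.succ_aleph0, Order.lt_succ_iff] at this
    rw [← Cardinal.le_aleph0_iff_set_countable]
    exact this
  refine ⟨r, h1, fun a => ((h1 a).insert a).mono fun b hb => ?_⟩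
  rcases trichotomous_of r a b with h | h | h
  · exact absurd h hb
  · exact Or.inl h.symm
  · exact Or.inr h

theorem not_shiftable (hCH : Cardinal.continuum = Cardinal.aleph 1) {X : Set Cantor}
    (hX : ¬ X.Countable) : ¬ Shiftable X := by
  obtain ⟨X', hsub, hX', hred⟩ := reduction hX
  obtain ⟨e, he⟩ := closed_code
  obtain ⟨r, hr1, hr2⟩ := exists_order hCH
  choose! R hR hRP t ht using hred
  have hy : ∀ z, ∃ x ∈ X', ∀ c, r c z → PerfectSet (e c) → z ≠ t (e c) →
      cAdd x z ∉ R (e c) := by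
    intro z
    by_contra hcon
    push Not at hcon
    apply hX'
    have : (⋃ c ∈ {c | r c z ∧ PerfectSet (e c) ∧ z ≠ t (e c)},
        {x ∈ X' | cAdd x z ∈ R (e c)}).Countable := by
      refine Set.Countable.biUnion ((hr1 z).mono fun c hc => hc.1) ?_
      rintro c ⟨-, h1, h2⟩
      exact ht _ h1 z h2
    refine this.mono fun x hx => ?_
    obtain ⟨c, h1, h2, h3, h4⟩ := hcon x hx
    exact Set.mem_biUnion (show c ∈ {c | _} from ⟨h1, h2, h3⟩) ⟨hx, h4⟩
  choose f hf1 hf2 using hy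
  intro hsh
  refine hsh (Set.range fun z => cAdd (f z) z) ?_ ?_
  · intro P hP
    obtain ⟨c, rfl⟩ := he P hP.1.closed
    have hcount : (Set.range (fun z => cAdd (f z) z) ∩ R (e c)).Countable := by
      refine (((hr2 c).insert (t (e c))).image fun z => cAdd (f z) z).mono ?_
      rintro _ ⟨⟨z, rfl⟩, hz⟩
      refine ⟨z, ?_, rfl⟩
      by_contra hcon
      simp only [Set.mem_insert_iff, Set.mem_ofPred_eq, not_or, not_not] at hcon
      exact hf2 z c hcon.2 hP hcon.1 hz
    obtain ⟨Q, hQ, hQR, hQd⟩ := perf_avoid (hR _ hP) hcount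
    refine ⟨Q, hQ, hQR.trans (hRP _ hP), ?_⟩
    ext x
    simp only [Set.mem_inter_iff, Set.mem_empty_iff_false, iff_false, not_and]
    intro hx hxr
    have : x ∈ Q ∩ (Set.range (fun z => cAdd (f z) z) ∩ R (e c)) := ⟨hx, hxr, hQR hx⟩
    rw [hQd] at this
    exact this
  · refine Set.eq_univ_of_forall fun z => ⟨f z, hsub (hf1 z), _, ⟨z, rfl⟩, ?_⟩
    show cAdd (f z) (cAdd (f z) z) = z
    rw [cAdd_comm, cAdd_comm (f z) z, cAdd_cancel]

theorem countable_shiftable {X : Set Cantor} (hX : X.Countable) : Shiftable X := by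
  intro Y hY hun
  have hne : X.Nonempty := by
    by_contra h
    rw [Set.not_nonempty_iff_eq_empty] at h
    subst h
    have : (fun _ => false : Cantor) ∈ setAdd ∅ Y := by rw [hun]; trivial
    simp [setAdd] at this
  obtain ⟨g, rfl⟩ := hX.exists_eq_range hne
  have step : ∀ (n : ℕ) (Q : Set Cantor), PerfectSet Q →
      ∃ Q', PerfectSet Q' ∧ Q' ⊆ Q ∧ ∀ w ∈ Q', cAdd w (g n) ∉ Y := by
    intro n Q hQ
    have tr : ∀ A, PerfectSet A → ∃ B, PerfectSet B ∧ ∀ w ∈ B, cAdd w (g n) ∈ A := by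
      intro A hA
      obtain ⟨B, hB, hBs⟩ := perf_sub (hA.1.closed.preimage (continuous_cAdd (g n))) (by
        intro hc
        apply perf_unc hA
        refine (hc.image fun x => cAdd x (g n)).mono ?_
        intro x hx
        refine ⟨cAdd x (g n), ?_, ?_⟩
        · show cAdd (cAdd x (g n)) (g n) ∈ A
          rwa [cAdd_cancel]
        · exact cAdd_cancel _ _)
      exact ⟨B, hB, fun w hw => hBs hw⟩
    obtain ⟨B, hB, hB1⟩ := tr Q hQ
    obtain ⟨B', hB', hs, hd⟩ := hY B hB
    obtain ⟨D, hD, hD1⟩ := tr B' hB'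
    refine ⟨D, hD, fun w hw => ?_, fun w hw hwY => ?_⟩
    · have := hB1 _ (hs (hD1 w hw))
      rwa [cAdd_cancel] at this
    · have : cAdd w (g n) ∈ B' ∩ Y := ⟨hD1 w hw, hwY⟩
      rw [hd] at this
      exact this
  choose! nx h1 h2 h3 using step
  obtain ⟨Q0, hQ0, -⟩ := perf_sub isClosed_univ not_countable_univ
  let S : ℕ → Set Cantor := fun k => Nat.rec Q0 (fun k F => nx k F) k
  have hS : ∀ k, PerfectSet (S k) := by
    intro k
    induction k with
    | zero => exact hQ0
    | succ k ih => exact h1 k _ ih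
  obtain ⟨w, hw⟩ := IsCompact.nonempty_iInter_of_sequence_nonempty_isCompact_isClosed S
    (fun k => h2 k _ (hS k)) (fun k => (hS k).2) (hS 0).1.closed.isCompact
    (fun k => (hS k).1.closed)
  rw [Set.mem_iInter] at hw
  have : w ∈ setAdd (Set.range g) Y := by rw [hun]; trivial
  obtain ⟨_, ⟨n, rfl⟩, y, hy, rfl⟩ := this
  apply h3 n _ (hS n) _ (hw (n + 1))
  rwa [cAdd_comm (g n) y, cAdd_cancel]

end MBC

theorem stmt11 (hCH : Cardinal.continuum = Cardinal.aleph 1) (X : Set Cantor) :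
    Shiftable X ↔ X.Countable := by
  constructor
  · intro h
    by_contra hX
    exact MBC.not_shiftable hCH hX h
  · exact MBC.countable_shiftable
end
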